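/- arXiv:1203.4935 — 2 statements merged into one kernel-verified Lean document; each statement's English description precedes it below -/
import Mathlib

section
/- Let p ≥ 3 and c > 0. There exists a > 0 such that for every τ > 0 and every coordinate i ∈ {1, …, p}, the Bayes coverage probability of the recentered coordinatewise interval exceeds that of the usual interval: ∫ P_θ({x : |θ_i − (δ⁺_a(x))_i| ≤ c}) dΠ_τ(θ) > ∫ P_θ({x : |θ_i − x_i| ≤ c}) dΠ_τ(θ), where the right-hand side equals P(|Z| ≤ c) for Z a standard one-dimensional normal. -/
open MeasureTheory ProbabilityTheory

/-- Euclidean norm on `Fin p → ℝ`. -/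
noncomputable def euclNorm {p : ℕ} (x : Fin p → ℝ) : ℝ := Real.sqrt (∑ i, (x i) ^ 2)

/-- Positive-part James–Stein estimator `δ⁺_a(x) = max(0, 1 - a/|x|²) • x`, with value `0` at `0`. -/
noncomputable def jsPlus {p : ℕ} (a : ℝ) (x : Fin p → ℝ) : Fin p → ℝ :=
  if x = 0 then 0 else (max 0 (1 - a / (euclNorm x) ^ 2)) • x

/-- The `p`-variate normal distribution `N(θ, I_p)`: the product measure whose `i`-th
coordinate is the one-dimensional Gaussian `N(θ i, 1)`. -/
noncomputable def gaussPi (p : ℕ) (θ : Fin p → ℝ) : Measure (Fin p → ℝ) :=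
  Measure.pi fun i => gaussianReal (θ i) 1

/-- The prior `N(0, τ² I_p)`: the product measure whose coordinates are `N(0, τ²)`. -/
noncomputable def priorPi (p : ℕ) (τ : ℝ) : Measure (Fin p → ℝ) :=
  Measure.pi fun _ => gaussianReal 0 (τ ^ 2).toNNReal

open scoped NNReal ENNReal

/-- A product of Gaussians has the product density. -/
lemma pi_gaussian_withDensity (p : ℕ) (m : Fin p → ℝ) (v : ℝ≥0) (hv : v ≠ 0) :
    Measure.pi (fun i => gaussianReal (m i) v) =
      (volume : Measure (Fin p → ℝ)).withDensity
        (fun x => ENNReal.ofReal (∏ i, gaussianPDFReal (m i) v (x i))) := by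
  refine Measure.pi_eq fun s hs => ?_
  have hbox : MeasurableSet (Set.univ.pi s) := MeasurableSet.univ_pi hs
  rw [withDensity_apply _ hbox]
  have hint : Integrable (fun x : Fin p → ℝ => ∏ i, gaussianPDFReal (m i) v (x i)) volume :=
    Integrable.fintype_prod (fun i => integrable_gaussianPDFReal (m i) v)
  rw [← ofReal_integral_eq_lintegral_ofReal hint.integrableOn
    (Filter.Eventually.of_forall fun x => Finset.prod_nonneg fun i _ => gaussianPDFReal_nonneg _ _ _)]
  rw [← integral_indicator hbox]
  have : (Set.univ.pi s).indicator (fun x : Fin p → ℝ => ∏ i, gaussianPDFReal (m i) v (x i))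
      = fun x => ∏ i, (s i).indicator (gaussianPDFReal (m i) v) (x i) := by
    funext x
    by_cases hx : x ∈ Set.univ.pi s
    · rw [Set.indicator_of_mem hx]
      exact Finset.prod_congr rfl fun i _ => (Set.indicator_of_mem (hx i trivial) _).symm
    · rw [Set.indicator_of_notMem hx]
      simp only [Set.mem_pi, Set.mem_univ, true_imp_iff, not_forall] at hx
      obtain ⟨i, hi⟩ := hx
      exact (Finset.prod_eq_zero (Finset.mem_univ i) (Set.indicator_of_notMem hi _)).symm
  rw [this, integral_fintype_prod_volume_eq_prod, ENNReal.ofReal_prod_of_nonneg]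
  · refine Finset.prod_congr rfl fun i _ => ?_
    rw [integral_indicator (hs i), gaussianReal_apply_eq_integral _ hv]
  · intro i _
    exact integral_nonneg fun x => Set.indicator_nonneg (fun _ _ => gaussianPDFReal_nonneg _ _ _) _

/-- Bayes formula for the densities. -/
lemma pdf_bayes (τ : ℝ) (hτ : 0 < τ) (t x : ℝ) :
    gaussianPDFReal 0 (τ ^ 2).toNNReal t * gaussianPDFReal t 1 x =
      gaussianPDFReal 0 (1 + τ ^ 2).toNNReal x *
        gaussianPDFReal (τ ^ 2 / (1 + τ ^ 2) * x) (τ ^ 2 / (1 + τ ^ 2)).toNNReal t := by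
  have h1 : 0 < 1 + τ ^ 2 := by positivity
  simp only [gaussianPDFReal, NNReal.coe_one]
  rw [Real.coe_toNNReal _ (by positivity), Real.coe_toNNReal _ (by positivity),
    Real.coe_toNNReal _ (by positivity)]
  have e1 : (√(2 * Real.pi * τ ^ 2))⁻¹ * (√(2 * Real.pi * 1))⁻¹ =
      (√(2 * Real.pi * (1 + τ ^ 2)))⁻¹ * (√(2 * Real.pi * (τ ^ 2 / (1 + τ ^ 2))))⁻¹ := by
    rw [← mul_inv, ← mul_inv, ← Real.sqrt_mul (by positivity), ← Real.sqrt_mul (by positivity)]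
    congr 2
    field_simp
  rw [mul_mul_mul_comm, e1, ← Real.exp_add]
  symm
  rw [mul_mul_mul_comm, ← Real.exp_add]
  congr 2
  field_simp
  ring

/-- Swapping prior/likelihood into marginal/posterior. -/
lemma bayes_swap (p : ℕ) (τ : ℝ) (hτ : 0 < τ) (A : Set ((Fin p → ℝ) × (Fin p → ℝ)))
    (hA : MeasurableSet A) :
    ∫⁻ θ, gaussPi p θ {x | (θ, x) ∈ A} ∂(priorPi p τ) =
      ∫⁻ x, (Measure.pi fun i => gaussianReal (τ ^ 2 / (1 + τ ^ 2) * x i)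
          (τ ^ 2 / (1 + τ ^ 2)).toNNReal) {θ | (θ, x) ∈ A}
        ∂(Measure.pi fun _ : Fin p => gaussianReal 0 (1 + τ ^ 2).toNNReal) := by
  have hv1 : (τ ^ 2).toNNReal ≠ 0 := by simp; positivity
  have hv2 : (1 + τ ^ 2).toNNReal ≠ 0 := by simp; positivity
  have hv3 : (τ ^ 2 / (1 + τ ^ 2)).toNNReal ≠ 0 := by simp; positivity
  have hmeas : ∀ v : ℝ≥0, Measurable (fun q : (Fin p → ℝ) × (Fin p → ℝ) =>
      ∏ i, gaussianPDFReal (q.1 i) v (q.2 i)) := by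
    intro v
    refine Finset.measurable_prod _ fun i _ => ?_
    simp only [gaussianPDFReal]
    fun_prop
  have hm0 : ∀ v : ℝ≥0, Measurable (fun x : Fin p → ℝ =>
      ENNReal.ofReal (∏ i, gaussianPDFReal 0 v (x i))) := by
    intro v
    refine ENNReal.measurable_ofReal.comp (Finset.measurable_prod _ fun i _ => ?_)
    simp only [gaussianPDFReal]
    fun_prop
  unfold gaussPi priorPi
  rw [pi_gaussian_withDensity p (fun _ => 0) _ hv1, pi_gaussian_withDensity p (fun _ => 0) _ hv2]
  have hs1 : ∀ θ, MeasurableSet {x | (θ, x) ∈ A} := fun θ => hA.preimage (by fun_prop)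
  have hs2 : ∀ x, MeasurableSet {θ | (θ, x) ∈ A} := fun x => hA.preimage (by fun_prop)
  have h1 : ∀ θ : Fin p → ℝ, (Measure.pi fun i => gaussianReal (θ i) 1) {x | (θ, x) ∈ A} =
      ∫⁻ x, A.indicator (fun q => ENNReal.ofReal (∏ i, gaussianPDFReal (q.1 i) 1 (q.2 i))) (θ, x) := by
    intro θ
    rw [pi_gaussian_withDensity p θ _ one_ne_zero, withDensity_apply _ (hs1 θ),
      ← lintegral_indicator (hs1 θ)]
    rfl
  set b := τ ^ 2 / (1 + τ ^ 2) with hb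
  have h2 : ∀ x : Fin p → ℝ, (Measure.pi fun i => gaussianReal (b * x i) b.toNNReal)
        {θ | (θ, x) ∈ A} =
      ∫⁻ θ, A.indicator (fun q => ENNReal.ofReal
        (∏ i, gaussianPDFReal (b * q.2 i) b.toNNReal (q.1 i))) (θ, x) := by
    intro x
    rw [pi_gaussian_withDensity p (fun i => b * x i) _ hv3, withDensity_apply _ (hs2 x),
      ← lintegral_indicator (hs2 x)]
    rfl
  simp only [h1, h2]
  have hm1 : Measurable (A.indicator
      (fun q => ENNReal.ofReal (∏ i, gaussianPDFReal (q.1 i) 1 (q.2 i)))) :=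
    (ENNReal.measurable_ofReal.comp (hmeas 1)).indicator hA
  have hm2 : Measurable (A.indicator
      (fun q => ENNReal.ofReal (∏ i, gaussianPDFReal (b * q.2 i) b.toNNReal (q.1 i)))) := by
    refine Measurable.indicator (ENNReal.measurable_ofReal.comp ?_) hA
    refine Finset.measurable_prod _ fun i _ => ?_
    simp only [gaussianPDFReal]
    fun_prop
  rw [lintegral_withDensity_eq_lintegral_mul _ (hm0 _) (Measurable.lintegral_prod_right' hm1),
    lintegral_withDensity_eq_lintegral_mul _ (hm0 _) (Measurable.lintegral_prod_left' hm2)]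
  simp only [Pi.mul_apply]
  have e1 : ∀ θ : Fin p → ℝ, ENNReal.ofReal (∏ i, gaussianPDFReal 0 (τ ^ 2).toNNReal (θ i)) *
      ∫⁻ x, A.indicator (fun q => ENNReal.ofReal (∏ i, gaussianPDFReal (q.1 i) 1 (q.2 i))) (θ, x) =
      ∫⁻ x, ENNReal.ofReal (∏ i, gaussianPDFReal 0 (τ ^ 2).toNNReal (θ i)) *
       A.indicator (fun q => ENNReal.ofReal (∏ i, gaussianPDFReal (q.1 i) 1 (q.2 i))) (θ, x) := by
    intro θ
    rw [lintegral_const_mul]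
    exact hm1.comp (by fun_prop)
  have e2 : ∀ x : Fin p → ℝ, ENNReal.ofReal (∏ i, gaussianPDFReal 0 (1 + τ ^ 2).toNNReal (x i)) *
      ∫⁻ θ, A.indicator (fun q => ENNReal.ofReal
        (∏ i, gaussianPDFReal (b * q.2 i) b.toNNReal (q.1 i))) (θ, x) =
      ∫⁻ θ, ENNReal.ofReal (∏ i, gaussianPDFReal 0 (1 + τ ^ 2).toNNReal (x i)) *
       A.indicator (fun q => ENNReal.ofReal
        (∏ i, gaussianPDFReal (b * q.2 i) b.toNNReal (q.1 i))) (θ, x) := by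
    intro x
    rw [lintegral_const_mul]
    exact hm2.comp (by fun_prop)
  simp only [e1, e2]
  rw [lintegral_lintegral_swap]
  · refine lintegral_congr fun x => lintegral_congr fun θ => ?_
    by_cases hq : (θ, x) ∈ A
    · rw [Set.indicator_of_mem hq, Set.indicator_of_mem hq, ← ENNReal.ofReal_mul,
        ← ENNReal.ofReal_mul, ← Finset.prod_mul_distrib, ← Finset.prod_mul_distrib]
      · congr 1
        exact Finset.prod_congr rfl fun i _ => pdf_bayes τ hτ _ _
      · exact Finset.prod_nonneg fun i _ => gaussianPDFReal_nonneg _ _ _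
      · exact Finset.prod_nonneg fun i _ => gaussianPDFReal_nonneg _ _ _
    · simp [Set.indicator_of_notMem hq]
  · refine Measurable.aemeasurable ?_
    exact ((hm0 _).comp measurable_fst).mul hm1

/-- Coverage of a centered normal of variance `v` by the interval of radius `c` around `t`. -/
noncomputable def covG (v : ℝ≥0) (c t : ℝ) : ℝ := ∫ u in (t - c)..(t + c), gaussianPDFReal 0 v u

lemma cont_pdf (v : ℝ≥0) : Continuous (gaussianPDFReal 0 v) := by
  unfold gaussianPDFReal
  fun_prop

lemma covG_gauss (m : ℝ) (v : ℝ≥0) (hv : v ≠ 0) (c d : ℝ) (hc : 0 < c) :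
    gaussianReal m v {t | |t - d| ≤ c} = ENNReal.ofReal (covG v c (d - m)) := by
  have hset : {t : ℝ | |t - d| ≤ c} = Set.Icc (d - c) (d + c) := by
    ext t
    simp only [Set.mem_ofPred_eq, Set.mem_Icc, abs_le]
    constructor <;> rintro ⟨h1, h2⟩ <;> constructor <;> linarith
  rw [hset, gaussianReal_apply_eq_integral _ hv, integral_Icc_eq_integral_Ioc,
    ← intervalIntegral.integral_of_le (by linarith)]
  congr 1
  unfold covG
  have := intervalIntegral.integral_comp_sub_right (a := d - c) (b := d + c)
    (gaussianPDFReal 0 v) m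
  rw [show d - m - c = d - c - m by ring, show d - m + c = d + c - m by ring, ← this]
  congr 1
  funext x
  rw [gaussianPDFReal_sub, zero_add]

lemma covG_neg (v : ℝ≥0) (c t : ℝ) : covG v c (-t) = covG v c t := by
  unfold covG
  have := intervalIntegral.integral_comp_neg (a := t - c) (b := t + c) (gaussianPDFReal 0 v)
  rw [show -t - c = -(t + c) by ring, show -t + c = -(t - c) by ring, ← this]
  congr 1
  funext x
  simp [gaussianPDFReal]

lemma covG_abs (v : ℝ≥0) (c t : ℝ) : covG v c |t| = covG v c t := by
  rcases abs_choice t with h | h <;> rw [h]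
  exact covG_neg _ _ _

lemma covG_cont (v : ℝ≥0) (c : ℝ) : Continuous (covG v c) := by
  have h1 : ∀ a b, IntervalIntegrable (gaussianPDFReal 0 v) volume a b :=
    fun a b => (cont_pdf v).intervalIntegrable a b
  have : covG v c = fun t => (∫ u in (0:ℝ)..(t + c), gaussianPDFReal 0 v u)
      - ∫ u in (0:ℝ)..(t - c), gaussianPDFReal 0 v u := by
    funext t
    rw [intervalIntegral.integral_interval_sub_left (h1 _ _) (h1 _ _)]
    rfl
  rw [this]
  have h2 := intervalIntegral.continuous_primitive h1 0
  exact (h2.comp (by fun_prop : Continuous fun t : ℝ => t + c)).sub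
    (h2.comp (by fun_prop : Continuous fun t : ℝ => t - c))

lemma covG_nonneg (v : ℝ≥0) (c t : ℝ) (hc : 0 < c) : 0 ≤ covG v c t :=
  intervalIntegral.integral_nonneg (by linarith) fun _ _ => gaussianPDFReal_nonneg _ _ _

lemma covG_le_one (v : ℝ≥0) (hv : v ≠ 0) (c t : ℝ) (hc : 0 < c) : covG v c t ≤ 1 := by
  have h := covG_gauss 0 v hv c t hc
  have h2 : gaussianReal 0 v {x | |x - t| ≤ c} ≤ 1 := prob_le_one
  rw [h, sub_zero] at h2
  simpa using h2

lemma covG_sub (v : ℝ≥0) (c t₁ t₂ : ℝ) :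
    covG v c t₁ - covG v c t₂ =
      ∫ u in t₁..t₂, (gaussianPDFReal 0 v (u - c) - gaussianPDFReal 0 v (u + c)) := by
  have h1 : ∀ a b, IntervalIntegrable (gaussianPDFReal 0 v) volume a b :=
    fun a b => (cont_pdf v).intervalIntegrable a b
  have c1 : Continuous fun u => gaussianPDFReal 0 v (u - c) := (cont_pdf v).comp (by fun_prop)
  have c2 : Continuous fun u => gaussianPDFReal 0 v (u + c) := (cont_pdf v).comp (by fun_prop)
  rw [intervalIntegral.integral_sub (c1.intervalIntegrable _ _) (c2.intervalIntegrable _ _),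
    intervalIntegral.integral_comp_sub_right (gaussianPDFReal 0 v),
    intervalIntegral.integral_comp_add_right (gaussianPDFReal 0 v)]
  unfold covG
  exact intervalIntegral.integral_interval_sub_interval_comm (h1 _ _) (h1 _ _) (h1 _ _)

lemma pdf_diff (v : ℝ≥0) (hv : v ≠ 0) (c u : ℝ) :
    gaussianPDFReal 0 v (u - c) - gaussianPDFReal 0 v (u + c) =
      gaussianPDFReal 0 v (u - c) * (1 - Real.exp (-(2 * u * c / v))) := by
  have hv' : (v : ℝ) ≠ 0 := by exact_mod_cast hv
  unfold gaussianPDFReal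
  have : Real.exp (-(u + c - 0) ^ 2 / (2 * v)) =
      Real.exp (-(u - c - 0) ^ 2 / (2 * v)) * Real.exp (-(2 * u * c / v)) := by
    rw [← Real.exp_add]
    congr 1
    field_simp
    ring
  rw [this]
  ring

lemma pdf_diff_nonneg (v : ℝ≥0) (hv : v ≠ 0) (c u : ℝ) (hc : 0 < c) (hu : 0 ≤ u) :
    0 ≤ gaussianPDFReal 0 v (u - c) - gaussianPDFReal 0 v (u + c) := by
  rw [pdf_diff v hv]
  refine mul_nonneg (gaussianPDFReal_nonneg _ _ _) ?_
  rw [sub_nonneg, Real.exp_le_one_iff]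
  have : 0 ≤ 2 * u * c / v := by positivity
  linarith

lemma cont_diff_pdf (v : ℝ≥0) (c : ℝ) :
    Continuous fun u => gaussianPDFReal 0 v (u - c) - gaussianPDFReal 0 v (u + c) :=
  ((cont_pdf v).comp (by fun_prop)).sub ((cont_pdf v).comp (by fun_prop))

lemma covG_anti (v : ℝ≥0) (hv : v ≠ 0) (c t₁ t₂ : ℝ) (hc : 0 < c) (h0 : 0 ≤ t₁) (h : t₁ ≤ t₂) :
    covG v c t₂ ≤ covG v c t₁ := by
  rw [← sub_nonneg, covG_sub]
  exact intervalIntegral.integral_nonneg h fun u hu =>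
    pdf_diff_nonneg v hv c u hc (h0.trans hu.1)

lemma covG_anti_abs (v : ℝ≥0) (hv : v ≠ 0) (c t₁ t₂ : ℝ) (hc : 0 < c) (h : |t₁| ≤ |t₂|) :
    covG v c t₂ ≤ covG v c t₁ := by
  rw [← covG_abs v c t₁, ← covG_abs v c t₂]
  exact covG_anti v hv c _ _ hc (abs_nonneg _) h

/-- Uniform quadratic upper bound for the loss near the origin. -/
lemma covG_loss (c : ℝ) (hc : 0 < c) : ∃ C : ℝ, 0 < C ∧ ∀ v : ℝ≥0, v ≠ 0 → v ≤ 1 →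
    ∀ t : ℝ, |t| ≤ c / 2 → covG v c 0 - covG v c t ≤ C * t ^ 2 := by
  refine ⟨2 * c * (2 / (c ^ 2 / 8) ^ 2), by positivity, fun v hv hv1 t ht => ?_⟩
  have hv0 : (0 : ℝ) < v := by positivity
  have hv1' : (v : ℝ) ≤ 1 := by exact_mod_cast hv1
  set C := 2 * c * (2 / (c ^ 2 / 8) ^ 2) with hC
  rw [← covG_abs v c t, covG_sub]
  have hbound : ∀ u ∈ Set.Icc 0 |t|,
      gaussianPDFReal 0 v (u - c) - gaussianPDFReal 0 v (u + c) ≤ C * |t| := by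
    intro u hu
    have huc : u ≤ c / 2 := hu.2.trans ht
    rw [pdf_diff v hv]
    have e1 : 1 - Real.exp (-(2 * u * c / v)) ≤ 2 * u * c / v := by
      have := Real.add_one_le_exp (-(2 * u * c / v)); linarith
    have e2 : gaussianPDFReal 0 v (u - c) ≤ (1 / v) * Real.exp (-((c ^ 2 / 8) / v)) := by
      unfold gaussianPDFReal
      have h3 : (v : ℝ) ≤ √(2 * Real.pi * v) := by
        apply Real.le_sqrt_of_sq_le
        nlinarith [Real.pi_gt_three]
      have h4 : (√(2 * Real.pi * v))⁻¹ ≤ 1 / v := by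
        rw [one_div]; exact inv_anti₀ hv0 h3
      refine mul_le_mul h4 (Real.exp_le_exp.mpr ?_) (Real.exp_nonneg _) (by positivity)
      rw [neg_div, neg_le_neg_iff, div_le_div_iff₀ hv0 (by positivity)]
      have hq : c ^ 2 / 4 ≤ (u - c - 0) ^ 2 := by nlinarith
      nlinarith
    have e3 : (1 / (v : ℝ)) ^ 2 * Real.exp (-((c ^ 2 / 8) / v)) ≤ 2 / (c ^ 2 / 8) ^ 2 := by
      have h5 := Real.quadratic_le_exp_of_nonneg (x := (c ^ 2 / 8) / v) (by positivity)
      rw [Real.exp_neg, ← div_eq_mul_inv, div_le_div_iff₀ (Real.exp_pos _) (by positivity)]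
      have h6 : 0 ≤ (c ^ 2 / 8) / (v : ℝ) := by positivity
      have h7 : (1 / (v:ℝ)) ^ 2 * (c ^ 2 / 8) ^ 2 = ((c ^ 2 / 8) / v) ^ 2 := by
        field_simp
      rw [h7]; linarith
    calc gaussianPDFReal 0 v (u - c) * (1 - Real.exp (-(2 * u * c / v)))
        ≤ gaussianPDFReal 0 v (u - c) * (2 * u * c / v) :=
          mul_le_mul_of_nonneg_left e1 (gaussianPDFReal_nonneg _ _ _)
      _ ≤ ((1 / v) * Real.exp (-((c ^ 2 / 8) / v))) * (2 * u * c / v) :=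
          mul_le_mul_of_nonneg_right e2 (by have := hu.1; positivity)
      _ = ((1 / v) ^ 2 * Real.exp (-((c ^ 2 / 8) / v))) * (2 * c * u) := by
          field_simp
      _ ≤ (2 / (c ^ 2 / 8) ^ 2) * (2 * c * u) :=
          mul_le_mul_of_nonneg_right e3 (by have := hu.1; positivity)
      _ = C * u := by rw [hC]; ring
      _ ≤ C * |t| := mul_le_mul_of_nonneg_left hu.2 (by positivity)
  calc ∫ u in (0:ℝ)..|t|, (gaussianPDFReal 0 v (u - c) - gaussianPDFReal 0 v (u + c))
      ≤ ∫ u in (0:ℝ)..|t|, C * |t| :=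
        intervalIntegral.integral_mono_on (abs_nonneg _)
          ((cont_diff_pdf v c).intervalIntegrable _ _) (by simp) hbound
    _ = C * t ^ 2 := by
        rw [intervalIntegral.integral_const, smul_eq_mul, sub_zero, ← sq_abs t]; ring

/-- Uniform lower bound for the gain. -/
lemma covG_gain (c : ℝ) (hc : 0 < c) : ∃ K : ℝ, 0 < K ∧ ∀ s : ℝ, 0 < s → s < 1 →
    K * s ^ 2 ≤ covG (1 - s ^ 2).toNNReal c (s * c) - covG (1 - s ^ 2).toNNReal c (s * (2 * c)) := by
  refine ⟨(c * (√(2 * Real.pi))⁻¹ * Real.exp (-(c ^ 2 / 2))) * (2 * c ^ 2 * Real.exp (-(2 * c ^ 2))),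
    by positivity, fun s hs hs1 => ?_⟩
  have hw : 0 < 1 - s ^ 2 := by nlinarith
  set v := (1 - s ^ 2).toNNReal with hv
  have hvc : (v : ℝ) = 1 - s ^ 2 := Real.coe_toNNReal _ hw.le
  have hv0 : v ≠ 0 := by rw [hv]; simpa using hw
  have hv0' : (0 : ℝ) < v := by rw [hvc]; exact hw
  set r := √(v : ℝ) with hr
  have hr0 : 0 < r := Real.sqrt_pos.2 hv0'
  have hr2 : r ^ 2 = v := Real.sq_sqrt hv0'.le
  have hr1 : r ≤ 1 := by nlinarith
  have hsr : 1 - s ≤ r := by nlinarith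
  have hstep : covG v c (s * (2 * c)) ≤ covG v c (s * c + s * r * c) := by
    refine covG_anti v hv0 c _ _ hc (by positivity) ?_
    nlinarith [mul_nonneg (mul_pos hs hc).le (sub_nonneg.2 hr1)]
  set M := ((√(2 * Real.pi))⁻¹ * r⁻¹ * Real.exp (-(c ^ 2 / 2))) *
    (2 * c ^ 2 * Real.exp (-(2 * c ^ 2)) * s) with hM
  have hlow : ∀ u ∈ Set.Icc (s * c) (s * c + s * r * c),
      M ≤ gaussianPDFReal 0 v (u - c) - gaussianPDFReal 0 v (u + c) := by
    intro u hu
    rw [pdf_diff v hv0]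
    have hu0 : 0 < u := lt_of_lt_of_le (by positivity) hu.1
    refine mul_le_mul ?_ ?_ (by positivity) (gaussianPDFReal_nonneg _ _ _)
    · unfold gaussianPDFReal
      rw [Real.sqrt_mul (by positivity : (0:ℝ) ≤ 2 * Real.pi) v, mul_inv, ← hr]
      refine mul_le_mul_of_nonneg_left (Real.exp_le_exp.2 ?_) (by positivity)
      have habs : |u - c| ≤ r * c := by
        rw [abs_le]
        constructor
        · nlinarith [hu.1, mul_nonneg hc.le (sub_nonneg.2 hsr)]
        · nlinarith [hu.2, mul_nonneg (mul_nonneg hc.le hr0.le) (sub_nonneg.2 hs1.le),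
            mul_nonneg hc.le (sub_nonneg.2 hs1.le)]
      have hsq : (u - c) ^ 2 ≤ v * c ^ 2 := by
        rw [← sq_abs, ← hr2, ← mul_pow]
        exact pow_le_pow_left₀ (abs_nonneg _) habs 2
      rw [neg_div, neg_le_neg_iff, sub_zero, div_le_div_iff₀ (by positivity) (by positivity)]
      linarith
    · have h1 : 2 * c ^ 2 * s ≤ 2 * u * c / v := by
        rw [le_div_iff₀ hv0']
        have hv1 : (v : ℝ) ≤ 1 := by rw [hvc]; nlinarith
        have : 2 * c ^ 2 * s ≤ 2 * u * c := by nlinarith [hu.1]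
        have h3 : 0 ≤ 2 * c ^ 2 * s := by positivity
        nlinarith
      have h2 : Real.exp (-(2 * u * c / v)) ≤ Real.exp (-(2 * c ^ 2 * s)) :=
        Real.exp_le_exp.2 (by linarith)
      have h3 := Real.add_one_le_exp (2 * c ^ 2 * s)
      have h4 : Real.exp (-(2 * c ^ 2)) ≤ Real.exp (-(2 * c ^ 2 * s)) :=
        Real.exp_le_exp.2 (by nlinarith [sq_nonneg c])
      have h5 : Real.exp (-(2 * c ^ 2 * s)) * Real.exp (2 * c ^ 2 * s) = 1 := by
        rw [← Real.exp_add]; simp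
      have h6 : Real.exp (-(2 * c ^ 2 * s)) * (2 * c ^ 2 * s + 1) ≤ 1 := by
        exact (mul_le_mul_of_nonneg_left h3 (Real.exp_nonneg _)).trans h5.le
      have h7 : Real.exp (-(2 * c ^ 2)) * (2 * c ^ 2 * s) ≤
          Real.exp (-(2 * c ^ 2 * s)) * (2 * c ^ 2 * s) :=
        mul_le_mul_of_nonneg_right h4 (by positivity)
      nlinarith
  have hint : M * (s * r * c) ≤ covG v c (s * c) - covG v c (s * c + s * r * c) := by
    rw [covG_sub]
    calc M * (s * r * c) = ∫ u in (s * c)..(s * c + s * r * c), M := by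
          rw [intervalIntegral.integral_const, smul_eq_mul]; ring
      _ ≤ _ := intervalIntegral.integral_mono_on (by nlinarith [mul_pos (mul_pos hs hr0) hc])
          (by simp) ((cont_diff_pdf v c).intervalIntegrable _ _) hlow
  have hMeq : M * (s * r * c) = (c * (√(2 * Real.pi))⁻¹ * Real.exp (-(c ^ 2 / 2))) *
      (2 * c ^ 2 * Real.exp (-(2 * c ^ 2))) * s ^ 2 := by
    rw [hM]
    have : r⁻¹ * r = 1 := inv_mul_cancel₀ hr0.ne'
    calc _ = (c * (√(2 * Real.pi))⁻¹ * Real.exp (-(c ^ 2 / 2))) *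
      (2 * c ^ 2 * Real.exp (-(2 * c ^ 2))) * s ^ 2 * (r⁻¹ * r) := by ring
      _ = _ := by rw [this, mul_one]
  linarith

lemma jsPlus_meas (p : ℕ) (a : ℝ) : Measurable (jsPlus (p := p) a) := by
  unfold jsPlus
  refine Measurable.ite (measurableSet_singleton 0) measurable_const ?_
  unfold euclNorm
  fun_prop

/-- Bayes coverage of a general measurable recentering as a Gaussian integral. -/
lemma bayes_cov (p : ℕ) (τ : ℝ) (hτ : 0 < τ) (c : ℝ) (hc : 0 < c) (i : Fin p)
    (s : ℝ) (hs : 0 < s) (hsτ : s ^ 2 * (1 + τ ^ 2) = 1)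
    (δ : (Fin p → ℝ) → ℝ) (hδ : Measurable δ) :
    ∫⁻ θ, gaussPi p θ {x : Fin p → ℝ | |θ i - δ x| ≤ c} ∂(priorPi p τ) =
      ENNReal.ofReal (∫ y, covG (1 - s ^ 2).toNNReal c
        (δ (fun j => s⁻¹ * y j) - (1 - s ^ 2) * (s⁻¹ * y i))
        ∂(Measure.pi fun _ : Fin p => gaussianReal 0 1)) := by
  have hA : MeasurableSet {q : (Fin p → ℝ) × (Fin p → ℝ) | |q.1 i - δ q.2| ≤ c} := by
    refine measurableSet_le ?_ measurable_const
    have : Measurable fun q : (Fin p → ℝ) × (Fin p → ℝ) => q.1 i - δ q.2 :=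
      ((measurable_pi_apply i).comp measurable_fst).sub (hδ.comp measurable_snd)
    exact continuous_abs.measurable.comp this
  have h1 : 0 < 1 + τ ^ 2 := by positivity
  have hb : τ ^ 2 / (1 + τ ^ 2) = 1 - s ^ 2 := by
    rw [div_eq_iff h1.ne']; linarith
  have hw : 0 < 1 - s ^ 2 := by rw [← hb]; positivity
  have hv0 : (1 - s ^ 2).toNNReal ≠ 0 := by simpa using hw
  have key := bayes_swap p τ hτ _ hA
  rw [hb] at key
  refine Eq.trans key ?_
  have hpost : ∀ x : Fin p → ℝ, (Measure.pi fun i => gaussianReal ((1 - s ^ 2) * x i)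
      (1 - s ^ 2).toNNReal) {θ : Fin p → ℝ | |θ i - δ x| ≤ c} =
      ENNReal.ofReal (covG (1 - s ^ 2).toNNReal c (δ x - (1 - s ^ 2) * x i)) := by
    intro x
    rw [← covG_gauss _ _ hv0 _ _ hc]
    have hm : MeasurableSet {t : ℝ | |t - δ x| ≤ c} :=
      measurableSet_le (by fun_prop) measurable_const
    exact (measurePreserving_eval (fun i => gaussianReal ((1 - s ^ 2) * x i)
      (1 - s ^ 2).toNNReal) i).measure_preimage hm.nullMeasurableSet
  simp only [Set.mem_ofPred_eq, hpost]
  have hmap : (Measure.pi fun _ : Fin p => gaussianReal 0 (1 + τ ^ 2).toNNReal) =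
      (Measure.pi fun _ : Fin p => gaussianReal 0 1).map (fun y j => s⁻¹ * y j) := by
    have h2 : (gaussianReal 0 1).map (fun y => s⁻¹ * y) = gaussianReal 0 (1 + τ ^ 2).toNNReal := by
      rw [gaussianReal_map_const_mul, mul_zero, mul_one]
      congr 1
      apply NNReal.coe_injective
      rw [Real.coe_toNNReal _ h1.le]
      change s⁻¹ ^ 2 = _
      rw [inv_pow]
      exact inv_eq_of_mul_eq_one_right hsτ
    rw [Measure.pi_map_pi (f := fun _ y => s⁻¹ * y) (fun _ => by fun_prop)]
    simp only [h2]
  have hmeas : Measurable fun x : Fin p → ℝ =>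
      covG (1 - s ^ 2).toNNReal c (δ x - (1 - s ^ 2) * x i) :=
    (covG_cont _ _).measurable.comp (hδ.sub (by fun_prop))
  rw [hmap, lintegral_map hmeas.ennreal_ofReal (by fun_prop)]
  rw [ofReal_integral_eq_lintegral_ofReal]
  · refine Integrable.of_bound (C := 1)
      (hmeas.comp (by fun_prop : Measurable fun (y : Fin p → ℝ) j => s⁻¹ * y j)).aestronglyMeasurable ?_
    refine Filter.Eventually.of_forall fun y => ?_
    rw [Real.norm_eq_abs, abs_of_nonneg (covG_nonneg _ _ _ hc)]
    exact covG_le_one _ hv0 _ _ hc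
  · exact Filter.Eventually.of_forall fun y => covG_nonneg _ _ _ hc

lemma usual_cov (p : ℕ) (τ : ℝ) (c : ℝ) (hc : 0 < c) (i : Fin p) :
    (∫⁻ θ, gaussPi p θ {x : Fin p → ℝ | |θ i - x i| ≤ c} ∂(priorPi p τ)) =
        gaussianReal 0 1 {z : ℝ | |z| ≤ c} := by
  have h : ∀ θ : Fin p → ℝ, gaussPi p θ {x : Fin p → ℝ | |θ i - x i| ≤ c} =
      gaussianReal 0 1 {z : ℝ | |z| ≤ c} := by
    intro θ
    have hm : MeasurableSet {t : ℝ | |t - θ i| ≤ c} :=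
      measurableSet_le (by fun_prop) measurable_const
    have e1 : gaussPi p θ {x : Fin p → ℝ | |θ i - x i| ≤ c} =
        gaussianReal (θ i) 1 {t : ℝ | |t - θ i| ≤ c} := by
      rw [← (measurePreserving_eval (fun i => gaussianReal (θ i) 1) i).measure_preimage
        hm.nullMeasurableSet]
      unfold gaussPi
      congr 1
      ext x
      simp [abs_sub_comm]
    have e2 := covG_gauss 0 1 one_ne_zero c 0 hc
    simp only [sub_zero] at e2
    rw [e1, covG_gauss _ _ one_ne_zero _ _ hc, sub_self, e2]
  simp only [h]
  unfold priorPi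
  simp

lemma rpow_int (r : ℝ) (hr : -1 < r) :
    Integrable (fun y : ℝ => |y| ^ r) (gaussianReal 0 1) := by
  rw [gaussianReal_of_var_ne_zero _ one_ne_zero]
  rw [integrable_withDensity_iff (measurable_gaussianPDF _ _)
    (Filter.Eventually.of_forall fun _ => gaussianPDF_lt_top)]
  simp only [toReal_gaussianPDF]
  have h1 : IntegrableOn (fun x : ℝ => x ^ r * Real.exp (-(1/2) * x ^ 2)) (Set.Ioi 0) :=
    (integrable_rpow_mul_exp_neg_mul_sq (by norm_num) hr).integrableOn
  have h2 : IntegrableOn (fun x : ℝ => |x| ^ r * gaussianPDFReal 0 1 x) (Set.Ioi 0) := by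
    refine IntegrableOn.congr_fun (f := fun x : ℝ => x ^ r * Real.exp (-(1/2) * x ^ 2) *
      (√(2 * Real.pi * 1))⁻¹) (Integrable.mul_const h1 _) ?_ measurableSet_Ioi
    intro x hx
    simp only [gaussianPDFReal, NNReal.coe_one]
    rw [abs_of_pos hx, show -(x - 0) ^ 2 / (2 * 1) = -(1/2) * x ^ 2 by ring]
    ring
  have h3 : IntegrableOn (fun x : ℝ => |x| ^ r * gaussianPDFReal 0 1 x) (Set.Iio 0) := by
    have h4 : IntegrableOn (fun x : ℝ => |x| ^ r * gaussianPDFReal 0 1 x) (Set.Ioi (-0)) := by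
      simpa using h2
    have h5 := h4.comp_neg_Iio
    have h6 : (fun x : ℝ => |(-x)| ^ r * gaussianPDFReal 0 1 (-x)) =
        fun x : ℝ => |x| ^ r * gaussianPDFReal 0 1 x := by
      funext x
      simp only [abs_neg, gaussianPDFReal, sub_zero, neg_sq]
    rwa [h6] at h5
  rw [← integrableOn_univ, ← Set.Iic_union_Ioi (a := (0:ℝ)), integrableOn_union]
  refine ⟨?_, h2⟩
  rwa [integrableOn_Iic_iff_integrableOn_Iio]


lemma js_arg (p : ℕ) (a s : ℝ) (hs : 0 < s) (y : Fin p → ℝ) (i : Fin p) (hy : y i ≠ 0) :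
    jsPlus a (fun j => s⁻¹ * y j) i - (1 - s ^ 2) * (s⁻¹ * y i) =
      (s - min 1 (a * s ^ 2 / ∑ l, y l ^ 2) / s) * y i := by
  have hx : (fun j => s⁻¹ * y j) ≠ 0 := by
    intro h
    have := congrFun h i
    simp [hs.ne', hy] at this
  have hN : (euclNorm fun j => s⁻¹ * y j) ^ 2 = (∑ l, y l ^ 2) / s ^ 2 := by
    unfold euclNorm
    rw [Real.sq_sqrt (Finset.sum_nonneg fun _ _ => sq_nonneg _), Finset.sum_div]
    refine Finset.sum_congr rfl fun l _ => ?_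
    field_simp
  unfold jsPlus
  rw [if_neg hx, hN, Pi.smul_apply, smul_eq_mul, div_div_eq_mul_div]
  have : max 0 (1 - a * s ^ 2 / ∑ l, y l ^ 2) = 1 - min 1 (a * s ^ 2 / ∑ l, y l ^ 2) := by
    rcases le_total 1 (a * s ^ 2 / ∑ l, y l ^ 2) with h | h
    · rw [min_eq_left h, max_eq_left (by linarith)]; ring
    · rw [min_eq_right h, max_eq_right (by linarith)]
  rw [this]
  field_simp
  ring

lemma loss_pt (c C : ℝ) (hc : 0 < c) (hC : 0 < C) (v : ℝ≥0) (hv : v ≠ 0)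
    (hloss : ∀ t : ℝ, |t| ≤ c / 2 → covG v c 0 - covG v c t ≤ C * t ^ 2)
    (a s N t : ℝ) (ha : 0 < a) (hac : 4 * a ≤ c ^ 2) (hs : 0 < s) (hN : 0 < N) (ht : t ^ 2 ≤ N) :
    -(C * s ^ 2 * a ^ 2 * N⁻¹) ≤
      covG v c ((s - min 1 (a * s ^ 2 / N) / s) * t) - covG v c (s * t) := by
  set m := min 1 (a * s ^ 2 / N) / s with hm
  have hm0 : 0 ≤ m := by positivity
  have hm1 : m * s ≤ 1 := by
    rw [hm, div_mul_cancel₀ _ hs.ne']; exact min_le_left _ _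
  have hm2 : m * N ≤ a * s := by
    have : m ≤ (a * s ^ 2 / N) / s := by
      rw [hm]; gcongr; exact min_le_right _ _
    calc m * N ≤ (a * s ^ 2 / N) / s * N := by gcongr
      _ = a * s := by field_simp
  have hrhs : 0 ≤ C * s ^ 2 * a ^ 2 * N⁻¹ := by positivity
  by_cases hk : |s - m| ≤ s
  · have : covG v c (s * t) ≤ covG v c ((s - m) * t) := by
      refine covG_anti_abs v hv c _ _ hc ?_
      rw [abs_mul, abs_mul, abs_of_pos hs]
      gcongr
    linarith
  · have hk' : s < m - s := by
      by_contra h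
      apply hk
      rw [abs_le]
      constructor <;> linarith
    have hsq : ((s - m) * t) ^ 2 ≤ m ^ 2 * N := by
      rw [mul_pow]
      exact mul_le_mul (by nlinarith) ht (sq_nonneg _) (sq_nonneg _)
    have hA : m ^ 2 * N ≤ a := by
      have h1 : m ^ 2 * N ≤ m * (a * s) := by nlinarith
      nlinarith
    have hB : m ^ 2 * N ≤ s ^ 2 * a ^ 2 * N⁻¹ := by
      rw [le_mul_inv_iff₀ hN]
      calc m ^ 2 * N * N = (m * N) ^ 2 := by ring
        _ ≤ (a * s) ^ 2 := pow_le_pow_left₀ (by positivity) hm2 2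
        _ = _ := by ring
    have habs : |(s - m) * t| ≤ c / 2 := by
      apply abs_le_of_sq_le_sq _ (by positivity)
      nlinarith
    have h1 := hloss _ habs
    have h2 : covG v c (s * t) ≤ covG v c 0 :=
      covG_anti_abs v hv c _ _ hc (by rw [abs_zero]; exact abs_nonneg _)
    have h3 : C * ((s - m) * t) ^ 2 ≤ C * (s ^ 2 * a ^ 2 * N⁻¹) :=
      mul_le_mul_of_nonneg_left (hsq.trans hB) hC.le
    nlinarith

lemma gain_pt (c : ℝ) (hc : 0 < c) (v : ℝ≥0) (hv : v ≠ 0)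
    (a s N Q t : ℝ) (ha : 0 < a) (hs : 0 < s) (hs1 : s < 1) (hN : a ≤ N) (hQ : N ≤ Q)
    (ht : c ≤ t) :
    covG v c (s * (t - c / Q * a)) ≤ covG v c ((s - min 1 (a * s ^ 2 / N) / s) * t) := by
  have hN0 : 0 < N := ha.trans_le hN
  have h1 : a * s ^ 2 / N ≤ 1 := by
    rw [div_le_one hN0]; nlinarith [mul_pos ha hs]
  rw [min_eq_right h1]
  have hk : (s - a * s ^ 2 / N / s) * t = s * (t - a * t / N) := by
    field_simp
  rw [hk]
  have ht0 : 0 < t := hc.trans_le ht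
  refine covG_anti v hv c _ _ hc ?_ ?_
  · apply mul_nonneg hs.le
    rw [sub_nonneg, div_le_iff₀ hN0]; nlinarith
  · apply mul_le_mul_of_nonneg_left _ hs.le
    have : c / Q ≤ t / N := by
      have : 0 < Q := hN0.trans_le hQ
      gcongr
    have h3 : a * t / N = t / N * a := by ring
    rw [h3]
    nlinarith

lemma gain_1d (c : ℝ) (hc : 0 < c) (v : ℝ≥0) (hv : v ≠ 0) (s h : ℝ) (hs : 0 < s)
    (hh : 0 < h) (hhc : h ≤ c) :
    gaussianPDFReal 0 1 (3 * c) * (h * (covG v c (s * c) - covG v c (s * (2 * c)))) ≤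
      ∫ t, (Set.Icc c (3 * c)).indicator
        (fun t => covG v c (s * (t - h)) - covG v c (s * t)) t ∂(gaussianReal 0 1) := by
  have hH : Continuous fun t => covG v c (s * t) := (covG_cont v c).comp (by fun_prop)
  have hH' : Continuous fun t => covG v c (s * (t - h)) := (covG_cont v c).comp (by fun_prop)
  have hanti : ∀ x y, 0 ≤ x → x ≤ y → covG v c (s * y) ≤ covG v c (s * x) := fun x y hx hxy =>
    covG_anti v hv c _ _ hc (by positivity) (by gcongr)
  have hI : ∀ a b, IntervalIntegrable (fun t => covG v c (s * t)) volume a b :=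
    fun a b => hH.intervalIntegrable a b
  rw [integral_gaussianReal_eq_integral_smul one_ne_zero]
  have e : ∀ t, gaussianPDFReal 0 1 t • (Set.Icc c (3 * c)).indicator
        (fun t => covG v c (s * (t - h)) - covG v c (s * t)) t =
      (Set.Icc c (3 * c)).indicator
        (fun t => gaussianPDFReal 0 1 t * (covG v c (s * (t - h)) - covG v c (s * t))) t := by
    intro t
    by_cases ht : t ∈ Set.Icc c (3 * c)
    · simp [Set.indicator_of_mem ht]
    · simp [Set.indicator_of_notMem ht]
  simp only [e]
  rw [integral_indicator measurableSet_Icc, integral_Icc_eq_integral_Ioc,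
    ← intervalIntegral.integral_of_le (by linarith)]
  have hstep : ∫ t in c..(3 * c), gaussianPDFReal 0 1 (3 * c) *
        (covG v c (s * (t - h)) - covG v c (s * t)) ≤
      ∫ t in c..(3 * c), gaussianPDFReal 0 1 t * (covG v c (s * (t - h)) - covG v c (s * t)) := by
    refine intervalIntegral.integral_mono_on (by linarith)
      (Continuous.intervalIntegrable (by fun_prop) _ _)
      (Continuous.intervalIntegrable ((cont_pdf 1).mul (hH'.sub hH)) _ _) ?_
    intro t ht
    refine mul_le_mul_of_nonneg_right ?_ ?_
    · unfold gaussianPDFReal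
      refine mul_le_mul_of_nonneg_left (Real.exp_le_exp.2 ?_) (by positivity)
      have : t ^ 2 ≤ (3 * c) ^ 2 := pow_le_pow_left₀ (hc.le.trans ht.1) ht.2 2
      simp only [NNReal.coe_one, sub_zero]
      linarith
    · have := hanti (t - h) t (by linarith [ht.1]) (by linarith)
      linarith
  refine le_trans ?_ hstep
  rw [intervalIntegral.integral_const_mul]
  refine mul_le_mul_of_nonneg_left ?_ (gaussianPDFReal_nonneg _ _ _)
  rw [intervalIntegral.integral_sub (hH'.intervalIntegrable _ _) (hI _ _),
    intervalIntegral.integral_comp_sub_right (fun t => covG v c (s * t)) h,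
    intervalIntegral.integral_interval_sub_interval_comm (hI _ _) (hI _ _) (hI _ _)]
  have l1 : h * covG v c (s * c) ≤ ∫ t in (c - h)..c, covG v c (s * t) := by
    calc h * covG v c (s * c) = ∫ t in (c - h)..c, covG v c (s * c) := by
          rw [intervalIntegral.integral_const, smul_eq_mul]; ring
      _ ≤ _ := intervalIntegral.integral_mono_on (by linarith) (by simp) (hI _ _)
          fun t ht => hanti t c (by linarith [ht.1]) ht.2
  have l2 : ∫ t in (3 * c - h)..(3 * c), covG v c (s * t) ≤ h * covG v c (s * (2 * c)) := by
    calc _ ≤ ∫ t in (3 * c - h)..(3 * c), covG v c (s * (2 * c)) :=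
          intervalIntegral.integral_mono_on (by linarith) (hI _ _) (by simp)
          fun t ht => hanti (2 * c) t (by linarith) (by linarith [ht.1])
      _ = _ := by rw [intervalIntegral.integral_const, smul_eq_mul]; ring
  linarith

lemma inv_sum_le (p : ℕ) (hp : 0 < p) (y : Fin p → ℝ) (hy : ∀ l, y l ≠ 0) :
    (∑ l, y l ^ 2)⁻¹ ≤ ∏ l, |y l| ^ (-2 / (p : ℝ)) := by
  set N := ∑ l, y l ^ 2 with hN
  have hle : ∀ l, y l ^ 2 ≤ N := fun l =>
    Finset.single_le_sum (f := fun l => y l ^ 2) (fun _ _ => sq_nonneg _) (Finset.mem_univ l)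
  have hp' : (0 : ℝ) < p := by exact_mod_cast hp
  have hN0 : 0 < N := lt_of_lt_of_le (by have := hy ⟨0, hp⟩; positivity) (hle ⟨0, hp⟩)
  have h1 : ∀ l, √N ^ (-2 / (p : ℝ)) ≤ |y l| ^ (-2 / (p : ℝ)) := by
    intro l
    refine Real.rpow_le_rpow_of_nonpos (abs_pos.2 (hy l)) ?_ ?_
    · exact Real.abs_le_sqrt (hle l)
    · exact div_nonpos_of_nonpos_of_nonneg (by norm_num) hp'.le
  calc N⁻¹ = ∏ _l : Fin p, √N ^ (-2 / (p : ℝ)) := by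
        rw [Finset.prod_const, Finset.card_univ, Fintype.card_fin, ← Real.rpow_natCast,
          ← Real.rpow_mul (Real.sqrt_nonneg _), div_mul_cancel₀ _ hp'.ne',
          Real.rpow_neg (Real.sqrt_nonneg _)]
        congr 1
        norm_cast
        exact (Real.sq_sqrt hN0.le).symm
    _ ≤ _ := Finset.prod_le_prod (fun _ _ => by positivity) fun l _ => h1 l

lemma main_real (p : ℕ) (hp : 3 ≤ p) (c : ℝ) (hc : 0 < c) :
    ∃ a : ℝ, 0 < a ∧ ∀ s : ℝ, 0 < s → s < 1 → ∀ i : Fin p,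
      ∫ y, covG (1 - s ^ 2).toNNReal c (s * y i) ∂(Measure.pi fun _ : Fin p => gaussianReal 0 1) <
      ∫ y, covG (1 - s ^ 2).toNNReal c
        (jsPlus a (fun j => s⁻¹ * y j) i - (1 - s ^ 2) * (s⁻¹ * y i))
        ∂(Measure.pi fun _ : Fin p => gaussianReal 0 1) := by
  obtain ⟨C, hC, hloss⟩ := covG_loss c hc
  obtain ⟨K, hK, hgain⟩ := covG_gain c hc
  have hp' : (0 : ℝ) < p := by exact_mod_cast (by omega : 0 < p)
  set γ := Measure.pi fun _ : Fin p => gaussianReal 0 1 with hγ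
  set F : (Fin p → ℝ) → ℝ := fun y => ∏ l, |y l| ^ (-2 / (p : ℝ)) with hF
  have hFint : Integrable F γ := by
    refine Integrable.fintype_prod (f := fun _ t => |t| ^ (-2 / (p : ℝ))) fun _ => rpow_int _ ?_
    rw [lt_div_iff₀ hp']
    have : (3 : ℝ) ≤ p := by exact_mod_cast hp
    linarith
  have hF0 : ∀ y, 0 ≤ F y := fun y => Finset.prod_nonneg fun l _ => by positivity
  set E := ∫ y, F y ∂γ with hE
  have hE0 : 0 ≤ E := integral_nonneg hF0
  set P := ∫ t, (Set.Icc (1 : ℝ) 2).indicator (fun _ => (1 : ℝ)) t ∂(gaussianReal 0 1) with hP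
  have hP0 : 0 < P := by
    rw [hP, integral_indicator measurableSet_Icc, setIntegral_const, smul_eq_mul, mul_one,
      measureReal_def]
    refine ENNReal.toReal_pos (fun h => ?_) (measure_ne_top _ _)
    have := gaussianReal_absolutelyContinuous' 0 (one_ne_zero (α := ℝ≥0)) h
    simp at this
  set Q : ℝ := 9 * c ^ 2 + 4 * p with hQ
  have hQ0 : 0 < Q := by positivity
  set φ := gaussianPDFReal 0 1 (3 * c) with hφ
  have hφ0 : 0 < φ := gaussianPDFReal_pos _ _ _ one_ne_zero
  set K1 := φ * (c / Q) * K * P ^ (p - 1) with hK1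
  have hK1pos : 0 < K1 := by positivity
  set a := min (min 1 (c ^ 2 / 4)) (K1 / (C * E + 1)) with ha
  have ha0 : 0 < a := by positivity
  have ha1 : a ≤ 1 := (min_le_left _ _).trans (min_le_left _ _)
  have ha2 : 4 * a ≤ c ^ 2 := by
    have : a ≤ c ^ 2 / 4 := (min_le_left _ _).trans (min_le_right _ _)
    linarith
  have ha3 : a * (C * E) < K1 := by
    have h1 : a ≤ K1 / (C * E + 1) := min_le_right _ _
    rw [le_div_iff₀ (by positivity)] at h1
    linarith
  refine ⟨a, ha0, fun s hs hs1 i => ?_⟩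
  have hw : 0 < 1 - s ^ 2 := by nlinarith
  set v := (1 - s ^ 2).toNNReal with hv
  have hv0 : v ≠ 0 := by rw [hv]; simpa using hw
  have hv1 : v ≤ 1 := by
    rw [hv, Real.toNNReal_le_one]
    nlinarith
  have hh0 : 0 < c / Q * a := by positivity
  have hhc : c / Q * a ≤ c := by
    have : 1 ≤ Q := by
      have : (3 : ℝ) ≤ p := by exact_mod_cast hp
      nlinarith [sq_nonneg c]
    calc c / Q * a ≤ c / Q * 1 := by gcongr
      _ ≤ c := by rw [mul_one]; exact div_le_self hc.le this
  set h := c / Q * a with hh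
  have hbd : ∀ g : (Fin p → ℝ) → ℝ, Measurable g → Integrable (fun y => covG v c (g y)) γ := by
    intro g hg
    refine Integrable.of_bound (C := 1)
      ((covG_cont v c).measurable.comp hg).aestronglyMeasurable ?_
    refine Filter.Eventually.of_forall fun y => ?_
    rw [Real.norm_eq_abs, abs_of_nonneg (covG_nonneg _ _ _ hc)]
    exact covG_le_one _ hv0 _ _ hc
  have hI1 := hbd (fun y => s * y i) (by fun_prop)
  have hI2 := hbd (fun y => jsPlus a (fun j => s⁻¹ * y j) i - (1 - s ^ 2) * (s⁻¹ * y i)) (by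
    refine Measurable.sub ?_ (by fun_prop)
    exact (measurable_pi_apply i).comp ((jsPlus_meas p a).comp (by fun_prop)))
  set f : Fin p → ℝ → ℝ := fun l => if l = i then
      (Set.Icc c (3 * c)).indicator (fun t => covG v c (s * (t - h)) - covG v c (s * t))
    else (Set.Icc (1 : ℝ) 2).indicator (fun _ => (1 : ℝ)) with hf
  have hfint : ∀ l, Integrable (f l) (gaussianReal 0 1) := by
    intro l
    simp only [hf]
    split_ifs
    · refine Integrable.indicator ?_ measurableSet_Icc
      have hb : ∀ g : ℝ → ℝ, Continuous g →
          Integrable (fun t => covG v c (g t)) (gaussianReal 0 1) := by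
        intro g hg
        refine Integrable.of_bound (C := 1)
          ((covG_cont v c).comp hg).aestronglyMeasurable ?_
        refine Filter.Eventually.of_forall fun y => ?_
        rw [Real.norm_eq_abs, abs_of_nonneg (covG_nonneg _ _ _ hc)]
        exact covG_le_one _ hv0 _ _ hc
      exact (hb _ (by fun_prop)).sub (hb _ (by fun_prop))
    · exact (integrable_const _).indicator measurableSet_Icc
  have hLint : Integrable (fun y : Fin p → ℝ => ∏ l, f l (y l)) γ :=
    Integrable.fintype_prod hfint
  have hLval : K1 * a * s ^ 2 ≤ ∫ y, ∏ l, f l (y l) ∂γ := by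
    rw [hγ, integral_fintype_prod_eq_prod f, ← Finset.mul_prod_erase _ _ (Finset.mem_univ i)]
    have e1 : ∏ l ∈ Finset.univ.erase i, ∫ t, f l t ∂(gaussianReal 0 1) = P ^ (p - 1) := by
      rw [Finset.prod_congr rfl (g := fun _ => P), Finset.prod_const,
        Finset.card_erase_of_mem (Finset.mem_univ i), Finset.card_univ, Fintype.card_fin]
      intro l hl
      simp only [hf, if_neg (Finset.ne_of_mem_erase hl), hP]
    rw [e1]
    have e2 := gain_1d c hc v hv0 s h hs hh0 hhc
    have e3 := hgain s hs hs1
    have e4 : φ * (h * (K * s ^ 2)) ≤ ∫ t, f i t ∂(gaussianReal 0 1) := by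
      simp only [hf, if_true]
      refine le_trans ?_ e2
      gcongr
    calc K1 * a * s ^ 2 = φ * (h * (K * s ^ 2)) * P ^ (p - 1) := by rw [hK1, hh]; ring
      _ ≤ _ := by gcongr
  have hae : ∀ᵐ y ∂γ, ∀ l, y l ≠ 0 := by
    rw [ae_all_iff]
    intro l
    have : NullSingletonClass (gaussianReal 0 1) := nullSingletonClass_gaussianReal one_ne_zero
    have h0 := Measure.pi_hyperplane (fun _ : Fin p => gaussianReal 0 1) l (0 : ℝ)
    rw [ae_iff]
    simpa using h0
  have hpt : ∀ᵐ y ∂γ, ∏ l, f l (y l) - C * s ^ 2 * a ^ 2 * F y ≤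
      covG v c (jsPlus a (fun j => s⁻¹ * y j) i - (1 - s ^ 2) * (s⁻¹ * y i)) -
        covG v c (s * y i) := by
    filter_upwards [hae] with y hy
    rw [js_arg p a s hs y i (hy i)]
    set N := ∑ l, y l ^ 2 with hN
    have hle : ∀ l, y l ^ 2 ≤ N := fun l =>
      Finset.single_le_sum (f := fun l => y l ^ 2) (fun _ _ => sq_nonneg _) (Finset.mem_univ l)
    have hN0 : 0 < N := lt_of_lt_of_le (by have := hy i; positivity) (hle i)
    by_cases hR : y i ∈ Set.Icc c (3 * c) ∧ ∀ l, l ≠ i → y l ∈ Set.Icc (1 : ℝ) 2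
    · have e1 : ∏ l, f l (y l) = covG v c (s * (y i - h)) - covG v c (s * y i) := by
        rw [← Finset.mul_prod_erase _ _ (Finset.mem_univ i), Finset.prod_eq_one, mul_one]
        · simp only [hf, if_true, Set.indicator_of_mem hR.1]
        · intro l hl
          have hl' := Finset.ne_of_mem_erase hl
          simp only [hf, if_neg hl', Set.indicator_of_mem (hR.2 l hl')]
      have hNa : a ≤ N := by
        have : Nontrivial (Fin p) := Fin.nontrivial_iff_two_le.2 (by omega)
        obtain ⟨j, hj⟩ := exists_ne i
        have := hR.2 j hj
        nlinarith [hle j, this.1]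
      have hNQ : N ≤ Q := by
        calc N ≤ ∑ l, ((if l = i then 9 * c ^ 2 else 0) + 4) := by
              refine Finset.sum_le_sum fun l _ => ?_
              split_ifs with hl
              · rw [hl]; nlinarith [hR.1.1, hR.1.2]
              · have := hR.2 l hl
                nlinarith [this.1, this.2]
          _ = Q := by
              rw [Finset.sum_add_distrib, Finset.sum_ite_eq' Finset.univ i]
              simp [hQ]
              ring
      have := gain_pt c hc v hv0 a s N Q (y i) ha0 hs hs1 hNa hNQ hR.1.1
      have h2 : 0 ≤ C * s ^ 2 * a ^ 2 * F y := mul_nonneg (by positivity) (hF0 y)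
      rw [e1]
      linarith
    · have e1 : ∏ l, f l (y l) = 0 := by
        rw [not_and_or] at hR
        rcases hR with hR | hR
        · refine Finset.prod_eq_zero (Finset.mem_univ i) ?_
          simp only [hf, if_true, Set.indicator_of_notMem hR]
        · push Not at hR
          obtain ⟨l, hl, hl2⟩ := hR
          refine Finset.prod_eq_zero (Finset.mem_univ l) ?_
          simp only [hf, if_neg hl, Set.indicator_of_notMem hl2]
      have h1 := loss_pt c C hc hC v hv0 (hloss v hv0 hv1) a s N (y i) ha0 ha2 hs hN0 (hle i)
      have h2 : C * s ^ 2 * a ^ 2 * N⁻¹ ≤ C * s ^ 2 * a ^ 2 * F y :=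
        mul_le_mul_of_nonneg_left (inv_sum_le p (by omega) y hy) (by positivity)
      rw [e1]
      linarith
  have hint := integral_mono_ae (hLint.sub (hFint.const_mul _)) (hI2.sub hI1) hpt
  simp only [Pi.sub_apply] at hint
  rw [integral_sub hLint (hFint.const_mul _), integral_sub hI2 hI1, integral_const_mul] at hint
  have hpos : 0 < (K1 - a * (C * E)) * (a * s ^ 2) := mul_pos (by linarith) (by positivity)
  have hfin : (K1 - a * (C * E)) * (a * s ^ 2) = K1 * a * s ^ 2 - C * s ^ 2 * a ^ 2 * E := by ring
  linarith


/-- He (1992): for `p ≥ 3` there is `a > 0` such that for every `τ > 0` and each coordinate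
`i`, the Bayes coverage probability of the recentered interval `(δ⁺_a(x))_i ± c` exceeds that
of the usual interval `x_i ± c`; the latter equals `P(|Z| ≤ c)` for a standard normal `Z`. -/
theorem stmt17 (p : ℕ) (hp : 3 ≤ p) (c : ℝ) (hc : 0 < c) :
    ∃ a : ℝ, 0 < a ∧ ∀ τ : ℝ, 0 < τ → ∀ i : Fin p,
      ((∫⁻ θ, gaussPi p θ {x : Fin p → ℝ | |θ i - jsPlus a x i| ≤ c} ∂(priorPi p τ)) >
        ∫⁻ θ, gaussPi p θ {x : Fin p → ℝ | |θ i - x i| ≤ c} ∂(priorPi p τ)) ∧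
      ((∫⁻ θ, gaussPi p θ {x : Fin p → ℝ | |θ i - x i| ≤ c} ∂(priorPi p τ)) =
        gaussianReal 0 1 {z : ℝ | |z| ≤ c}) := by
  obtain ⟨a, ha, hmain⟩ := main_real p hp c hc
  refine ⟨a, ha, fun τ hτ i => ⟨?_, usual_cov p τ c hc i⟩⟩
  have h1 : 0 < 1 + τ ^ 2 := by positivity
  set s := (√(1 + τ ^ 2))⁻¹ with hs
  have hs0 : 0 < s := by positivity
  have hsτ : s ^ 2 * (1 + τ ^ 2) = 1 := by
    rw [hs, inv_pow, Real.sq_sqrt h1.le, inv_mul_cancel₀ h1.ne']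
  have hs1 : s < 1 := by
    by_contra h
    push Not at h
    have : 1 ≤ s ^ 2 := one_le_pow₀ h
    nlinarith [pow_pos hτ 2]
  rw [gt_iff_lt, bayes_cov p τ hτ c hc i s hs0 hsτ (fun x => x i) (by fun_prop),
    bayes_cov p τ hτ c hc i s hs0 hsτ (fun x => jsPlus a x i)
      ((measurable_pi_apply i).comp (jsPlus_meas p a))]
  have hlt := hmain s hs0 hs1 i
  have e : ∀ y : Fin p → ℝ, s⁻¹ * y i - (1 - s ^ 2) * (s⁻¹ * y i) = s * y i := by
    intro y
    field_simp
    ring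
  simp only [e]
  rw [ENNReal.ofReal_lt_ofReal_iff']
  exact ⟨hlt, lt_of_le_of_lt (integral_nonneg fun y => covG_nonneg _ _ _ hc) hlt⟩
end

section
/- Let p ≥ 1, c > 0, and k = e^{−c²/2}/(2π)^{p/2}. Then the usual confidence procedure D⁰ = {(θ, x) : |θ − x| ≤ c} is minimax for the linear loss: for every measurable confidence procedure D ⊆ ℝ^p × ℝ^p, sup_θ R(θ, D) ≥ sup_θ R(θ, D⁰) = k·λ(B_c) − P(|Z| ≤ c), where B_c is the closed Euclidean ball of radius c in ℝ^p and Z ~ N(0, I_p). -/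
open MeasureTheory ProbabilityTheory

/-- Risk of a confidence procedure `D ⊆ ℝ^p × ℝ^p` (with `x`-sections `D_x = {θ : (θ,x) ∈ D}`)
under the linear loss `L(θ, C) = k·λ(C) − 1{θ ∈ C}`:
`R(θ, D) = k·∫ λ(D_x) dP_θ(x) − P_θ(θ ∈ D_X)`, valued in `EReal`. -/
noncomputable def linearRisk (p : ℕ) (k : ENNReal)
    (D : Set ((Fin p → ℝ) × (Fin p → ℝ))) (θ : Fin p → ℝ) : EReal :=
  ((k * ∫⁻ x, volume {t : Fin p → ℝ | (t, x) ∈ D} ∂(gaussPi p θ) : ENNReal) : EReal) -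
    ((gaussPi p θ {x : Fin p → ℝ | (θ, x) ∈ D} : ENNReal) : EReal)

open Filter Topology
open scoped ENNReal

/-- Standard Gaussian density on `Fin p → ℝ`. -/
noncomputable def phiG (p : ℕ) (z : Fin p → ℝ) : ℝ≥0∞ :=
  ENNReal.ofReal (∏ i, gaussianPDFReal 0 1 (z i))

/-- Slowly varying prior weight. -/
noncomputable def priorW (p : ℕ) (d : ℝ) (z : Fin p → ℝ) : ℝ≥0∞ :=
  ENNReal.ofReal (((1 + d * ‖z‖)⁻¹) ^ (p + 1))

lemma phiG_meas (p : ℕ) : Measurable (phiG p) := by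
  unfold phiG
  refine ENNReal.measurable_ofReal.comp ?_
  refine Finset.measurable_prod _ fun i _ => ?_
  exact (measurable_gaussianPDFReal 0 1).comp (measurable_pi_apply i)

lemma priorW_meas (p : ℕ) (d : ℝ) : Measurable (priorW p d) := by
  unfold priorW
  fun_prop

lemma phiG_ne_top (p : ℕ) (z) : phiG p z ≠ ⊤ := ENNReal.ofReal_ne_top

lemma gaussPi_eq (p : ℕ) (θ : Fin p → ℝ) :
    gaussPi p θ = volume.withDensity (fun x => phiG p (x - θ)) := by
  unfold gaussPi
  refine Measure.pi_eq fun s hs => ?_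
  rw [withDensity_apply _ (MeasurableSet.univ_pi hs)]
  have hint : Integrable (fun x : Fin p → ℝ => ∏ i, gaussianPDFReal (θ i) 1 (x i))
      (Measure.pi fun i => (volume : Measure ℝ).restrict (s i)) :=
    Integrable.fintype_prod_dep (f := fun i => gaussianPDFReal (θ i) 1)
      (fun i => (integrable_gaussianPDFReal (θ i) 1).restrict)
  have h1 : ∀ x : Fin p → ℝ, phiG p (x - θ) =
      ENNReal.ofReal (∏ i, gaussianPDFReal (θ i) 1 (x i)) := by
    intro x
    unfold phiG
    congr 1
    refine Finset.prod_congr rfl fun i _ => ?_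
    rw [Pi.sub_apply, gaussianPDFReal_sub, zero_add]
  simp_rw [h1]
  rw [volume_pi, Measure.restrict_pi_pi, ← ofReal_integral_eq_lintegral_ofReal hint
    (Eventually.of_forall fun x => Finset.prod_nonneg fun i _ => gaussianPDFReal_nonneg _ _ _),
    integral_fintype_prod_eq_prod (fun i => gaussianPDFReal (θ i) 1),
    ENNReal.ofReal_prod_of_nonneg
      (fun i _ => integral_nonneg fun x => gaussianPDFReal_nonneg _ _ _)]
  refine Finset.prod_congr rfl fun i _ => ?_
  rw [gaussianReal_apply_eq_integral _ one_ne_zero]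

lemma phiG_eq (p : ℕ) (z : Fin p → ℝ) :
    phiG p z = ENNReal.ofReal (Real.exp (-(euclNorm z) ^ 2 / 2) / (2 * Real.pi) ^ ((p : ℝ) / 2)) := by
  unfold phiG euclNorm
  congr 1
  rw [Real.sq_sqrt (Finset.sum_nonneg fun i _ => sq_nonneg _)]
  simp only [gaussianPDFReal, NNReal.coe_one, mul_one, sub_zero]
  rw [Finset.prod_mul_distrib, ← Real.exp_sum, Finset.prod_const, Finset.card_univ,
    Fintype.card_fin, ← Finset.sum_div, Finset.sum_neg_distrib, div_eq_mul_inv _ (_ ^ _), mul_comm]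
  congr 1
  rw [Real.sqrt_eq_rpow, inv_pow, ← Real.rpow_natCast, ← Real.rpow_mul (by positivity)]
  congr 2
  ring

lemma lintegral_phiG (p : ℕ) : ∫⁻ z, phiG p z = 1 := by
  have h := gaussPi_eq p 0
  have h2 : gaussPi p 0 Set.univ = 1 := by
    unfold gaussPi
    exact measure_univ
  rw [h, withDensity_apply _ MeasurableSet.univ] at h2
  simpa using h2

lemma priorW_le_one (p : ℕ) {d : ℝ} (hd : 0 < d) (z) : priorW p d z ≤ 1 := by
  unfold priorW
  rw [ENNReal.ofReal_le_one]
  refine pow_le_one₀ (by positivity) ?_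
  refine inv_le_one_of_one_le₀ ?_
  have : 0 ≤ d * ‖z‖ := by positivity
  linarith

lemma priorW_mul_le (p : ℕ) {d : ℝ} (hd : 0 < d) (x y : Fin p → ℝ) :
    priorW p d x * priorW p d y ≤ priorW p d (x + y) := by
  unfold priorW
  rw [← ENNReal.ofReal_mul (by positivity), ← mul_pow, ← mul_inv]
  refine ENNReal.ofReal_le_ofReal (pow_le_pow_left₀ (by positivity) ?_ _)
  refine inv_anti₀ (by positivity) ?_
  have h1 := norm_add_le x y
  have h2 : 0 ≤ (d * ‖x‖) * (d * ‖y‖) := by positivity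
  nlinarith

lemma priorW_neg (p : ℕ) (d : ℝ) (x : Fin p → ℝ) : priorW p d (-x) = priorW p d x := by
  simp [priorW]

lemma priorW_pos (p : ℕ) {d : ℝ} (hd : 0 < d) (x : Fin p → ℝ) : 0 < priorW p d x := by
  unfold priorW
  rw [ENNReal.ofReal_pos]
  positivity

lemma lintegral_priorW_ne_top (p : ℕ) {d : ℝ} (hd : 0 < d) (hd1 : d ≤ 1) :
    ∫⁻ z, priorW p d z ≠ ⊤ := by
  have h := finite_integral_one_add_norm (E := Fin p → ℝ) (μ := volume) (r := (p + 1 : ℕ))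
    (by simp)
  have h2 : ∀ z, priorW p d z ≤ ENNReal.ofReal ((d⁻¹) ^ (p + 1)) *
      ENNReal.ofReal ((1 + ‖z‖) ^ (-((p + 1 : ℕ) : ℝ))) := by
    intro z
    unfold priorW
    rw [← ENNReal.ofReal_mul (by positivity), Real.rpow_neg (by positivity), Real.rpow_natCast,
      ← inv_pow (1 + ‖z‖), ← mul_pow, ← mul_inv]
    refine ENNReal.ofReal_le_ofReal (pow_le_pow_left₀ (by positivity) ?_ _)
    refine inv_anti₀ (by positivity) ?_
    nlinarith
  refine ne_top_of_le_ne_top ?_ (lintegral_mono h2)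
  rw [lintegral_const_mul' _ _ ENNReal.ofReal_ne_top]
  exact ENNReal.mul_ne_top ENNReal.ofReal_ne_top h.ne

lemma lintegral_priorW_ne_zero (p : ℕ) {d : ℝ} (hd : 0 < d) :
    ∫⁻ z, priorW p d z ≠ 0 := by
  rw [Ne, lintegral_eq_zero_iff (priorW_meas p d)]
  intro h
  have h2 : ∀ᵐ _z : Fin p → ℝ, False := h.mono fun z hz => (priorW_pos p hd z).ne' hz
  simp only [eventually_false_iff_eq_bot, ae_eq_bot] at h2
  exact (NeZero.ne (volume : Measure (Fin p → ℝ))) h2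

/-- The smoothing constant. -/
noncomputable def smoothA (p : ℕ) (d : ℝ) : ℝ≥0∞ := ∫⁻ z, priorW p d z * phiG p z

/-- The truncated excess function. -/
noncomputable def gTr (p : ℕ) (k : ℝ≥0∞) (d : ℝ) (z : Fin p → ℝ) : ℝ≥0∞ :=
  phiG p z - k * smoothA p d * priorW p d z

lemma gTr_meas (p : ℕ) (k : ℝ≥0∞) (d : ℝ) : Measurable (gTr p k d) :=
  (phiG_meas p).sub ((priorW_meas p d).const_mul _)

lemma smooth_ge (p : ℕ) {d : ℝ} (hd : 0 < d) (x : Fin p → ℝ) :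
    smoothA p d * priorW p d x ≤ ∫⁻ η, priorW p d η * phiG p (x - η) := by
  rw [← lintegral_sub_left_eq_self (fun η => priorW p d η * phiG p (x - η)) x]
  unfold smoothA
  have hmm : Measurable (fun z => priorW p d z * phiG p z) := (priorW_meas p d).mul (phiG_meas p)
  rw [← lintegral_mul_const _ hmm]
  refine lintegral_mono fun z => ?_
  have h := priorW_mul_le p hd x (-z)
  rw [priorW_neg, ← sub_eq_add_neg] at h
  simp only [sub_sub_cancel]
  calc priorW p d z * phiG p z * priorW p d x
      = (priorW p d x * priorW p d z) * phiG p z := by ring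
    _ ≤ _ := mul_le_mul_left h _

lemma ptwise (p : ℕ) (k : ℝ≥0∞) {d : ℝ} (hd : 0 < d) (θ x : Fin p → ℝ) :
    priorW p d θ * phiG p (x - θ) ≤
      k * (∫⁻ η, priorW p d η * phiG p (x - η)) + priorW p d θ * gTr p k d (x - θ) := by
  have h1 : phiG p (x - θ) ≤ k * smoothA p d * priorW p d (x - θ) + gTr p k d (x - θ) :=
    le_add_tsub
  have h2 := priorW_mul_le p hd θ (x - θ)
  rw [add_sub_cancel] at h2
  calc priorW p d θ * phiG p (x - θ)
      ≤ priorW p d θ * (k * smoothA p d * priorW p d (x - θ) + gTr p k d (x - θ)) := by gcongr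
    _ = k * (smoothA p d * (priorW p d θ * priorW p d (x - θ)))
        + priorW p d θ * gTr p k d (x - θ) := by ring
    _ ≤ k * (smoothA p d * priorW p d x) + priorW p d θ * gTr p k d (x - θ) := by gcongr
    _ ≤ _ := by
      gcongr
      exact smooth_ge p hd x

lemma bayes_bound (p : ℕ) (k : ℝ≥0∞) (m : ℝ≥0∞)
    (D : Set ((Fin p → ℝ) × (Fin p → ℝ))) (hD : MeasurableSet D)
    (h : ∀ θ, k * (∫⁻ x, volume {t : Fin p → ℝ | (t, x) ∈ D} ∂(gaussPi p θ)) + m ≤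
      gaussPi p θ {x : Fin p → ℝ | (θ, x) ∈ D}) {d : ℝ} (hd : 0 < d) (hd1 : d ≤ 1) :
    m ≤ ∫⁻ z, gTr p k d z := by
  set W : (Fin p → ℝ) → ℝ≥0∞ := fun x => ∫⁻ η, priorW p d η * phiG p (x - η) with hW
  set V : (Fin p → ℝ) → ℝ≥0∞ := fun x => volume {t : Fin p → ℝ | (t, x) ∈ D} with hV
  have hpm := priorW_meas p d
  have hfm := phiG_meas p
  have hgm := gTr_meas p k d
  have hVm : Measurable V := measurable_measure_prodMk_right hD
  have hWm : Measurable W := by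
    refine Measurable.lintegral_prod_right' (f := fun q : (Fin p → ℝ) × (Fin p → ℝ) =>
      priorW p d q.2 * phiG p (q.1 - q.2)) ?_
    exact (hpm.comp measurable_snd).mul (hfm.comp (measurable_fst.sub measurable_snd))
  set I : (Fin p → ℝ) → (Fin p → ℝ) → ℝ≥0∞ := fun θ x => D.indicator (fun _ => 1) (θ, x) with hI
  have hIm : Measurable (Function.uncurry I) := measurable_one.indicator hD
  have hIm1 : ∀ θ, Measurable (I θ) := fun θ => hIm.comp measurable_prodMk_left
  have hIm2 : ∀ x, Measurable (fun θ => I θ x) := fun x => hIm.comp measurable_prodMk_right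
  have hIV : ∀ x, ∫⁻ θ, I θ x = V x := by
    intro x
    have : MeasurableSet {t : Fin p → ℝ | (t, x) ∈ D} := measurable_prodMk_right hD
    rw [hV]
    simp only
    rw [← lintegral_indicator_one this]
    rfl
  -- first term
  have hA : ∫⁻ θ, priorW p d θ * ∫⁻ x, V x ∂(gaussPi p θ) = ∫⁻ x, W x * V x := by
    have : ∀ θ, priorW p d θ * ∫⁻ x, V x ∂(gaussPi p θ) =
        ∫⁻ x, priorW p d θ * phiG p (x - θ) * V x := by
      intro θ
      have hm : Measurable (fun x => phiG p (x - θ)) := hfm.comp (measurable_id.sub_const θ)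
      rw [gaussPi_eq, lintegral_withDensity_eq_lintegral_mul _ hm hVm,
        ← lintegral_const_mul _ (hm.mul hVm)]
      simp only [Pi.mul_apply, mul_assoc]
    simp_rw [this]
    rw [lintegral_lintegral_swap]
    · refine lintegral_congr fun x => ?_
      rw [lintegral_mul_const]
      exact hpm.mul (hfm.comp (measurable_const.sub measurable_id))
    · refine Measurable.aemeasurable ?_
      exact ((hpm.comp measurable_fst).mul
        (hfm.comp (measurable_snd.sub measurable_fst))).mul (hVm.comp measurable_snd)
  have hB : ∀ θ, priorW p d θ * gaussPi p θ {x : Fin p → ℝ | (θ, x) ∈ D} =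
      ∫⁻ x, I θ x * (priorW p d θ * phiG p (x - θ)) := by
    intro θ
    have hm : Measurable (fun x => phiG p (x - θ)) := hfm.comp (measurable_id.sub_const θ)
    have hs : MeasurableSet {x : Fin p → ℝ | (θ, x) ∈ D} := measurable_prodMk_left hD
    rw [gaussPi_eq, withDensity_apply _ hs, ← lintegral_indicator hs,
      ← lintegral_const_mul _ (hm.indicator hs)]
    refine lintegral_congr fun x => ?_
    by_cases hx : (θ, x) ∈ D
    · simp [hI, Set.indicator, hx]
    · simp [hI, Set.indicator, hx]
  set P := ∫⁻ θ, priorW p d θ with hP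
  have hPt : P ≠ ⊤ := lintegral_priorW_ne_top p hd hd1
  have hP0 : P ≠ 0 := lintegral_priorW_ne_zero p hd
  have hlow : k * (∫⁻ x, W x * V x) + P * m ≤
      ∫⁻ θ, priorW p d θ * gaussPi p θ {x : Fin p → ℝ | (θ, x) ∈ D} := by
    calc k * (∫⁻ x, W x * V x) + P * m
        ≤ (∫⁻ θ, k * (priorW p d θ * ∫⁻ x, V x ∂(gaussPi p θ))) + ∫⁻ θ, priorW p d θ * m := by
          rw [← hA, lintegral_mul_const _ hpm]
          gcongr
          exact lintegral_const_mul_le _ _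
      _ = ∫⁻ θ, (k * (priorW p d θ * ∫⁻ x, V x ∂(gaussPi p θ)) + priorW p d θ * m) := by
          rw [lintegral_add_right _ (hpm.mul_const m)]
      _ ≤ _ := by
          refine lintegral_mono fun θ => ?_
          calc k * (priorW p d θ * ∫⁻ x, V x ∂(gaussPi p θ)) + priorW p d θ * m
              = priorW p d θ * (k * (∫⁻ x, V x ∂(gaussPi p θ)) + m) := by ring
            _ ≤ _ := by
              gcongr
              exact h θ
  have hup : ∫⁻ θ, priorW p d θ * gaussPi p θ {x : Fin p → ℝ | (θ, x) ∈ D} ≤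
      k * (∫⁻ x, W x * V x) + P * ∫⁻ z, gTr p k d z := by
    simp_rw [hB]
    have hstep : ∀ θ, ∫⁻ x, I θ x * (priorW p d θ * phiG p (x - θ)) ≤
        (∫⁻ x, k * W x * I θ x) + priorW p d θ * ∫⁻ z, gTr p k d z := by
      intro θ
      have hg' : Measurable (fun x => gTr p k d (x - θ)) := hgm.comp (measurable_id.sub_const θ)
      rw [← lintegral_sub_right_eq_self (fun z => gTr p k d z) θ,
        ← lintegral_const_mul _ hg', ← lintegral_add_right _ (hg'.const_mul _)]
      refine lintegral_mono fun x => ?_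
      by_cases hx : (θ, x) ∈ D
      · simpa [hI, hx] using ptwise p k hd θ x
      · simp [hI, hx]
    refine (lintegral_mono hstep).trans ?_
    rw [lintegral_add_right _ (hpm.mul_const _), lintegral_mul_const _ hpm]
    gcongr
    rw [lintegral_lintegral_swap]
    · have hmm : Measurable (fun x => W x * V x) := hWm.mul hVm
      rw [← lintegral_const_mul _ hmm]
      refine lintegral_mono fun x => ?_
      simp only
      rw [lintegral_const_mul _ (hIm2 x), hIV x, mul_assoc]
    · refine Measurable.aemeasurable ?_
      exact ((hWm.comp measurable_snd).const_mul k).mul hIm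
  have hfin : ∫⁻ θ, priorW p d θ * gaussPi p θ {x : Fin p → ℝ | (θ, x) ∈ D} ≠ ⊤ := by
    refine ne_top_of_le_ne_top hPt (lintegral_mono fun θ => ?_)
    have : gaussPi p θ {x : Fin p → ℝ | (θ, x) ∈ D} ≤ 1 := by
      unfold gaussPi
      exact prob_le_one
    calc _ ≤ priorW p d θ * 1 := by gcongr
      _ = _ := mul_one _
  have hK : k * (∫⁻ x, W x * V x) ≠ ⊤ :=
    ne_top_of_le_ne_top hfin (le_self_add.trans hlow)
  have h3 := (ENNReal.add_le_add_iff_left hK).1 (hlow.trans hup)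
  exact (ENNReal.mul_le_mul_iff_right hP0 hPt).1 h3

lemma priorW_tendsto (p : ℕ) (z : Fin p → ℝ) :
    Tendsto (fun n : ℕ => priorW p (1 / ((n : ℝ) + 1)) z) atTop (𝓝 1) := by
  have h0 : Tendsto (fun n : ℕ => (1 / ((n : ℝ) + 1))) atTop (𝓝 0) :=
    tendsto_one_div_add_atTop_nhds_zero_nat
  have h1 : Tendsto (fun n : ℕ => ((1 + (1 / ((n : ℝ) + 1)) * ‖z‖)⁻¹) ^ (p + 1)) atTop
      (𝓝 (((1 + 0 * ‖z‖)⁻¹) ^ (p + 1))) := by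
    refine Tendsto.pow (Tendsto.inv₀ ((h0.mul_const _).const_add 1) (by simp)) _
  have h2 := (ENNReal.continuous_ofReal.tendsto _).comp h1
  simpa [priorW, Function.comp_def] using h2

lemma smoothA_tendsto (p : ℕ) :
    Tendsto (fun n : ℕ => smoothA p (1 / ((n : ℝ) + 1))) atTop (𝓝 1) := by
  rw [← lintegral_phiG p]
  refine tendsto_lintegral_of_dominated_convergence (phiG p)
    (fun n => (priorW_meas p _).mul (phiG_meas p)) (fun n => Eventually.of_forall fun z => ?_)
    (by rw [lintegral_phiG]; simp) (Eventually.of_forall fun z => ?_)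
  · calc _ ≤ 1 * phiG p z := mul_le_mul_left (priorW_le_one p (by positivity) z) _
      _ = _ := one_mul _
  · have := ENNReal.Tendsto.mul_const (b := phiG p z) (priorW_tendsto p z) (Or.inl one_ne_zero)
    simpa using this

lemma gTr_tendsto (p : ℕ) (k : ℝ≥0∞) (hk : k ≠ ⊤) :
    Tendsto (fun n : ℕ => ∫⁻ z, gTr p k (1 / ((n : ℝ) + 1)) z) atTop
      (𝓝 (∫⁻ z, (phiG p z - k))) := by
  refine tendsto_lintegral_of_dominated_convergence (phiG p)
    (fun n => gTr_meas p k _) (fun n => Eventually.of_forall fun z => tsub_le_self)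
    (by rw [lintegral_phiG]; simp) (Eventually.of_forall fun z => ?_)
  have h1 := ENNReal.Tendsto.mul (ENNReal.Tendsto.const_mul (a := k) (smoothA_tendsto p)
    (Or.inr hk)) (Or.inr (by simp)) (priorW_tendsto p z) (Or.inr (by simpa using hk))
  rw [mul_one, mul_one] at h1
  exact ENNReal.Tendsto.sub tendsto_const_nhds h1 (Or.inl (phiG_ne_top p z))

lemma euclNorm_meas (p : ℕ) : Measurable (euclNorm (p := p)) := by
  unfold euclNorm
  fun_prop

lemma euclNorm_neg {p : ℕ} (x : Fin p → ℝ) : euclNorm (-x) = euclNorm x := by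
  simp [euclNorm]

lemma risk_const (p : ℕ) (c : ℝ) (k : ℝ≥0∞) (θ : Fin p → ℝ) :
    linearRisk p k {q : (Fin p → ℝ) × (Fin p → ℝ) | euclNorm (q.1 - q.2) ≤ c} θ =
      ((k * volume {t : Fin p → ℝ | euclNorm t ≤ c} : ENNReal) : EReal) -
        ((gaussPi p 0 {x : Fin p → ℝ | euclNorm x ≤ c} : ENNReal) : EReal) := by
  have hm : MeasurableSet {t : Fin p → ℝ | euclNorm t ≤ c} :=
    measurableSet_le (euclNorm_meas p) measurable_const
  have h1 : ∀ x : Fin p → ℝ, volume {t : Fin p → ℝ | euclNorm (t - x) ≤ c} =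
      volume {t : Fin p → ℝ | euclNorm t ≤ c} := by
    intro x
    simpa [sub_eq_add_neg] using
      measure_preimage_add_right volume (-x) {t : Fin p → ℝ | euclNorm t ≤ c}
  have hs : {x : Fin p → ℝ | euclNorm (θ - x) ≤ c} = {x : Fin p → ℝ | euclNorm (x - θ) ≤ c} := by
    ext x
    simp only [Set.mem_ofPred_eq]
    rw [← euclNorm_neg, neg_sub]
  have hm2 : MeasurableSet {t : Fin p → ℝ | euclNorm (t - θ) ≤ c} :=
    measurableSet_le ((euclNorm_meas p).comp (measurable_id.sub_const θ)) measurable_const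
  have h2 : gaussPi p θ {x : Fin p → ℝ | euclNorm (θ - x) ≤ c} =
      gaussPi p 0 {x : Fin p → ℝ | euclNorm x ≤ c} := by
    rw [hs, gaussPi_eq, gaussPi_eq, withDensity_apply _ hm, withDensity_apply _ hm2,
      ← lintegral_indicator hm, ← lintegral_indicator hm2,
      ← lintegral_sub_right_eq_self (Set.indicator {t : Fin p → ℝ | euclNorm t ≤ c} _) θ]
    refine lintegral_congr fun x => ?_
    simp [Set.indicator]
  have h3 : gaussPi p θ Set.univ = 1 := by
    unfold gaussPi
    exact measure_univ
  unfold linearRisk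
  simp only [Set.mem_ofPred_eq]
  simp_rw [h1]
  rw [h2, lintegral_const, h3, mul_one]

lemma excess_add (p : ℕ) (c : ℝ) (hc : 0 < c) (k : ℝ≥0∞)
    (hk : k = ENNReal.ofReal (Real.exp (-c ^ 2 / 2) / (2 * Real.pi) ^ ((p : ℝ) / 2))) :
    (∫⁻ z, (phiG p z - k)) + k * volume {t : Fin p → ℝ | euclNorm t ≤ c} =
      gaussPi p 0 {x : Fin p → ℝ | euclNorm x ≤ c} := by
  have hm : MeasurableSet {t : Fin p → ℝ | euclNorm t ≤ c} :=
    measurableSet_le (euclNorm_meas p) measurable_const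
  rw [gaussPi_eq, withDensity_apply _ hm, ← lintegral_indicator hm, ← lintegral_indicator_const hm,
    ← lintegral_add_right _ (measurable_const.indicator hm)]
  refine lintegral_congr fun z => ?_
  have h0 : 0 ≤ euclNorm z := Real.sqrt_nonneg _
  by_cases hz : euclNorm z ≤ c
  · have : k ≤ phiG p z := by
      rw [hk, phiG_eq]
      refine ENNReal.ofReal_le_ofReal ?_
      gcongr
    simp [Set.indicator, hz, tsub_add_cancel_of_le this]
  · have : phiG p z ≤ k := by
      rw [hk, phiG_eq]
      refine ENNReal.ofReal_le_ofReal ?_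
      push Not at hz
      gcongr
    simp [Set.indicator, hz, tsub_eq_zero_of_le this]

/-- With `k = e^{−c²/2}/(2π)^{p/2}`, the usual procedure `D⁰ = {(θ,x) : |θ − x| ≤ c}` is
minimax for the linear loss, with minimax risk `k·λ(B_c) − P(|Z| ≤ c)`. -/
theorem stmt18 (p : ℕ) (hp : 1 ≤ p) (c : ℝ) (hc : 0 < c)
    (k : ENNReal) (hk : k = ENNReal.ofReal (Real.exp (-c ^ 2 / 2) / (2 * Real.pi) ^ ((p : ℝ) / 2)))
    (D : Set ((Fin p → ℝ) × (Fin p → ℝ))) (hD : MeasurableSet D) :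
    (⨆ θ : Fin p → ℝ, linearRisk p k D θ) ≥
      (⨆ θ : Fin p → ℝ, linearRisk p k {q : (Fin p → ℝ) × (Fin p → ℝ) | euclNorm (q.1 - q.2) ≤ c} θ) ∧
    (⨆ θ : Fin p → ℝ, linearRisk p k {q : (Fin p → ℝ) × (Fin p → ℝ) | euclNorm (q.1 - q.2) ≤ c} θ) =
      ((k * volume {t : Fin p → ℝ | euclNorm t ≤ c} : ENNReal) : EReal) -
        ((gaussPi p 0 {x : Fin p → ℝ | euclNorm x ≤ c} : ENNReal) : EReal) := by

  simp_rw [risk_const]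
  rw [ciSup_const]
  refine ⟨?_, rfl⟩
  have hkt : k ≠ ⊤ := hk ▸ ENNReal.ofReal_ne_top
  have hex := excess_add p c hc k hk
  set M := ∫⁻ z, (phiG p z - k) with hM
  set V := k * volume {t : Fin p → ℝ | euclNorm t ≤ c} with hV
  set G := gaussPi p 0 {x : Fin p → ℝ | euclNorm x ≤ c} with hG
  have hGt : G ≠ ⊤ := by
    refine ne_top_of_le_ne_top ENNReal.one_ne_top ?_
    rw [hG]
    unfold gaussPi
    exact prob_le_one
  have hMt : M ≠ ⊤ := ne_top_of_le_ne_top hGt (le_self_add.trans hex.le)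
  have hVt : V ≠ ⊤ := ne_top_of_le_ne_top hGt (le_add_self.trans hex.le)
  have hr : ((V : ℝ≥0∞) : EReal) - ((G : ℝ≥0∞) : EReal) = ((-M.toReal : ℝ) : EReal) := by
    rw [← EReal.coe_ennreal_toReal hVt, ← EReal.coe_ennreal_toReal hGt, ← EReal.coe_sub, ← hex,
      ENNReal.toReal_add hMt hVt]
    congr 1
    ring
  rw [hr]
  by_contra hlt
  rw [ge_iff_le, not_le] at hlt
  obtain ⟨s, hs1, hs2⟩ := EReal.lt_iff_exists_real_btwn.1 hlt
  have hs3 : s < -M.toReal := by exact_mod_cast hs2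
  have hM0 : 0 ≤ M.toReal := ENNReal.toReal_nonneg
  have key : ∀ θ, k * (∫⁻ x, volume {t : Fin p → ℝ | (t, x) ∈ D} ∂(gaussPi p θ)) +
      ENNReal.ofReal (-s) ≤ gaussPi p θ {x : Fin p → ℝ | (θ, x) ∈ D} := by
    intro θ
    have hθ : linearRisk p k D θ < (s : EReal) := (le_iSup _ θ).trans_lt hs1
    unfold linearRisk at hθ
    set A := k * (∫⁻ x, volume {t : Fin p → ℝ | (t, x) ∈ D} ∂(gaussPi p θ))
    have hBt : gaussPi p θ {x : Fin p → ℝ | (θ, x) ∈ D} ≠ ⊤ := by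
      refine ne_top_of_le_ne_top ENNReal.one_ne_top ?_
      unfold gaussPi
      exact prob_le_one
    set B := gaussPi p θ {x : Fin p → ℝ | (θ, x) ∈ D}
    have hAt : A ≠ ⊤ := by
      intro hA
      rw [hA, ← EReal.coe_ennreal_toReal hBt, EReal.coe_ennreal_top, EReal.top_sub_coe] at hθ
      exact not_top_lt hθ
    rw [← EReal.coe_ennreal_toReal hAt, ← EReal.coe_ennreal_toReal hBt, ← EReal.coe_sub,
      EReal.coe_lt_coe_iff] at hθ
    rw [← ENNReal.ofReal_toReal hAt, ← ENNReal.ofReal_toReal hBt,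
      ← ENNReal.ofReal_add ENNReal.toReal_nonneg (by linarith)]
    exact ENNReal.ofReal_le_ofReal (by linarith)
  have hle : ENNReal.ofReal (-s) ≤ M := by
    refine ge_of_tendsto' (gTr_tendsto p k hkt) fun n => ?_
    refine bayes_bound p k _ D hD key (by positivity) ?_
    rw [div_le_one (by positivity)]
    have : (0 : ℝ) ≤ n := n.cast_nonneg
    linarith
  have := ENNReal.toReal_mono hMt hle
  rw [ENNReal.toReal_ofReal (by linarith)] at this
  linarith
end
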